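/- arXiv:2411.19476 — 2 statements merged into one kernel-verified Lean document; each statement's English description precedes it below -/
import Mathlib

section
/- Suppose the twin-set graph (H, TS(H)) arises from a decomposition tree, and suppose that for every twin-set graph H' occurring in this construction and every 0 ≤ k ≤ |TS(H')| the family D_k(H') is nonempty. Then Equation (2) holds for H. -/
/-- A finite simple graph on a subset of an ambient vertex type `α`,
together with a designated twin set `TS ⊆ verts`. -/
structure TSGraph (α : Type*) where
  verts : Finset α
  Adj : α → α → Prop
  symm : ∀ u v, Adj u v → Adj v u
  irrefl : ∀ u, ¬ Adj u u
  adj_mem : ∀ u v, Adj u v → u ∈ verts ∧ v ∈ verts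
  TS : Finset α
  TS_sub : TS ⊆ verts

namespace TSGraph

variable {α : Type*} [DecidableEq α]

/-- `f` encodes a perfect matching of the subgraph of `G` induced by `S`:
every vertex of `S` is paired with an adjacent vertex of `S`, involutively. -/
def IsPM (G : TSGraph α) (S : Finset α) (f : α → α) : Prop :=
  ∀ v ∈ S, f v ∈ S ∧ G.Adj v (f v) ∧ f (f v) = v

/-- `S ⊆ V(G)` dominates `V(G) − TS(G)` and, for some `X ⊆ S ∩ TS(G)` of size `k`,
the subgraph induced by `S − X` has a perfect matching. -/
def Adm (G : TSGraph α) (k : ℕ) (S : Finset α) : Prop :=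
  S ⊆ G.verts ∧
  (∀ v ∈ G.verts, v ∉ G.TS → v ∈ S ∨ ∃ u ∈ S, G.Adj u v) ∧
  ∃ X ⊆ S ∩ G.TS, X.card = k ∧ ∃ f, G.IsPM (S \ X) f

/-- Membership in the family `D_k(G)`: admissible of minimum cardinality. -/
def memD (G : TSGraph α) (k : ℕ) (S : Finset α) : Prop :=
  G.Adm k S ∧ ∀ S', G.Adm k S' → S.card ≤ S'.card

/-- `D_k(G) ≠ ∅`. -/
def DkNonempty (G : TSGraph α) (k : ℕ) : Prop := ∃ S, G.memD k S

/-- `D_k(G) ≠ ∅` for all `0 ≤ k ≤ |TS(G)|`. -/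
def AllDkNonempty (G : TSGraph α) : Prop := ∀ k ≤ G.TS.card, G.DkNonempty k

/-- `γ_k(G)`: the common cardinality of the members of `D_k(G)`. -/
noncomputable def gamma (G : TSGraph α) (k : ℕ) : ℕ :=
  sInf {n | ∃ S, G.Adm k S ∧ S.card = n}

/-- A paired-dominating set of `G`. -/
def IsPDS (G : TSGraph α) (D : Finset α) : Prop :=
  D ⊆ G.verts ∧
  (∀ v ∈ G.verts, v ∈ D ∨ ∃ u ∈ D, G.Adj u v) ∧
  ∃ f, G.IsPM D f

/-- `γ_p(G)`: the paired-domination number. -/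
noncomputable def gammaP (G : TSGraph α) : ℕ :=
  sInf {n | ∃ D, G.IsPDS D ∧ D.card = n}

/-- Membership in `D_p(G)`: minimum-cardinality paired-dominating sets. -/
def memDp (G : TSGraph α) (D : Finset α) : Prop :=
  G.IsPDS D ∧ D.card = G.gammaP

/-- `min(G) = min { γ_k(G) : 0 ≤ k ≤ |TS(G)| }`. -/
noncomputable def minVal (G : TSGraph α) : ℕ :=
  sInf {n | ∃ k ≤ G.TS.card, G.gamma k = n}

/-- `α(G)`: the smallest `k` with `γ_k(G) = min(G)`. -/
noncomputable def alphaVal (G : TSGraph α) : ℕ :=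
  sInf {k | k ≤ G.TS.card ∧ G.gamma k = G.minVal}

/-- `β(G)`: the largest `k` with `γ_k(G) = min(G)`. -/
noncomputable def betaVal (G : TSGraph α) : ℕ :=
  sSup {k | k ≤ G.TS.card ∧ G.gamma k = G.minVal}

/-- Membership in `Ψ(G)`: sets in some `D_k(G)` of cardinality `min(G)`. -/
def memPsi (G : TSGraph α) (D : Finset α) : Prop :=
  (∃ k, k ≤ G.TS.card ∧ G.memD k D) ∧ D.card = G.minVal

/-- Equation (2) holds for `G`. -/
def Eq2Holds (G : TSGraph α) : Prop :=
  ∀ k ≤ G.TS.card,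
    (k ≤ G.alphaVal → G.gamma k = G.minVal + G.alphaVal - k) ∧
    (G.betaVal ≤ k → G.gamma k = G.minVal + k - G.betaVal) ∧
    (G.alphaVal < k → k < G.betaVal → Even (k - G.alphaVal) → G.gamma k = G.minVal) ∧
    (G.alphaVal < k → k < G.betaVal → ¬ Even (k - G.alphaVal) → G.gamma k = G.minVal + 1)

/-- `G = Gl ⊗ Gr` (true twin composition). -/
def IsTrueTwin (G Gl Gr : TSGraph α) : Prop :=
  Disjoint Gl.verts Gr.verts ∧
  G.verts = Gl.verts ∪ Gr.verts ∧
  (∀ u v, G.Adj u v ↔ Gl.Adj u v ∨ Gr.Adj u v ∨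
    (u ∈ Gl.TS ∧ v ∈ Gr.TS) ∨ (u ∈ Gr.TS ∧ v ∈ Gl.TS)) ∧
  G.TS = Gl.TS ∪ Gr.TS

/-- `G = Gl ⊙ Gr` (false twin composition). -/
def IsFalseTwin (G Gl Gr : TSGraph α) : Prop :=
  Disjoint Gl.verts Gr.verts ∧
  G.verts = Gl.verts ∪ Gr.verts ∧
  (∀ u v, G.Adj u v ↔ Gl.Adj u v ∨ Gr.Adj u v) ∧
  G.TS = Gl.TS ∪ Gr.TS

/-- `G = Gl ⊕ Gr` (attachment composition). -/
def IsAttach (G Gl Gr : TSGraph α) : Prop :=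
  Disjoint Gl.verts Gr.verts ∧
  G.verts = Gl.verts ∪ Gr.verts ∧
  (∀ u v, G.Adj u v ↔ Gl.Adj u v ∨ Gr.Adj u v ∨
    (u ∈ Gl.TS ∧ v ∈ Gr.TS) ∨ (u ∈ Gr.TS ∧ v ∈ Gl.TS)) ∧
  G.TS = Gl.TS

/-- The twin-set graph `G` arises from a decomposition tree all of whose associated
twin-set graphs satisfy the property `P`. -/
inductive FromDecompTree (P : TSGraph α → Prop) : TSGraph α → Prop where
  | single (G : TSGraph α) (v : α) (hv : G.verts = {v}) (hts : G.TS = {v})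
      (hadj : ∀ u w, ¬ G.Adj u w) (hP : P G) : FromDecompTree P G
  | ttwin (G Gl Gr : TSGraph α) (hl : FromDecompTree P Gl) (hr : FromDecompTree P Gr)
      (h : IsTrueTwin G Gl Gr) (hP : P G) : FromDecompTree P G
  | ftwin (G Gl Gr : TSGraph α) (hl : FromDecompTree P Gl) (hr : FromDecompTree P Gr)
      (h : IsFalseTwin G Gl Gr) (hP : P G) : FromDecompTree P G
  | attach (G Gl Gr : TSGraph α) (hl : FromDecompTree P Gl) (hr : FromDecompTree P Gr)
      (h : IsAttach G Gl Gr) (hP : P G) : FromDecompTree P G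

end TSGraph

namespace TSGraph

/-- The model shape function. -/
def F (mu a b k : ℕ) : ℕ := mu + max (max (a - k) (k - b)) ((k + a) % 2)

theorem F_le {mu a b k x : ℕ} :
    F mu a b k ≤ x ↔ mu + a ≤ x + k ∧ mu + k ≤ x + b ∧ mu + (k + a) % 2 ≤ x := by
  unfold F
  rcases max_cases (max (a - k) (k - b)) ((k + a) % 2) with ⟨h, h'⟩ | ⟨h, h'⟩ <;>
  rcases max_cases (a - k) (k - b) with ⟨g, g'⟩ | ⟨g, g'⟩ <;> rw [h] <;> omega

theorem F_ge (mu a b k : ℕ) :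
    mu + a ≤ F mu a b k + k ∧ mu + k ≤ F mu a b k + b ∧ mu + (k + a) % 2 ≤ F mu a b k :=
  F_le.1 le_rfl

theorem F_low {mu a b k : ℕ} (h : k ≤ a) (hab : a ≤ b) : F mu a b k = mu + (a - k) := by
  have := F_ge mu a b k
  have : F mu a b k ≤ mu + (a - k) := F_le.2 (by omega)
  omega

theorem F_high {mu a b k : ℕ} (h : b ≤ k) (hab : a ≤ b) (hp : a % 2 = b % 2) :
    F mu a b k = mu + (k - b) := by
  have := F_ge mu a b k
  have : F mu a b k ≤ mu + (k - b) := F_le.2 (by omega)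
  omega

theorem F_mid {mu a b k : ℕ} (h : a ≤ k) (hab : k ≤ b) :
    F mu a b k = mu + (k + a) % 2 := by
  have := F_ge mu a b k
  have : F mu a b k ≤ mu + (k + a) % 2 := F_le.2 (by omega)
  omega

theorem F_succ (mu a b k : ℕ) : F mu a b (k + 1) ≤ F mu a b k + 1 := by
  have := F_ge mu a b k
  rw [F_le]; omega

theorem F_pred (mu a b k : ℕ) : F mu a b k ≤ F mu a b (k + 1) + 1 := by
  have := F_ge mu a b (k + 1)
  rw [F_le]; omega

theorem false_low (mu1 a1 b1 mu2 a2 b2 p q : ℕ) :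
    F (mu1 + mu2) (a1 + a2) (b1 + b2) (p + q) ≤ F mu1 a1 b1 p + F mu2 a2 b2 q := by
  have h1 := F_ge mu1 a1 b1 p
  have h2 := F_ge mu2 a2 b2 q
  rw [F_le]; omega

theorem false_up {mu1 a1 b1 n1 mu2 a2 b2 n2 k : ℕ} (hab1 : a1 ≤ b1) (hb1 : b1 ≤ n1)
    (hp1 : a1 % 2 = b1 % 2) (hab2 : a2 ≤ b2) (hb2 : b2 ≤ n2)
    (hp2 : a2 % 2 = b2 % 2) (hk : k ≤ n1 + n2) :
    ∃ i j, i ≤ n1 ∧ j ≤ n2 ∧ i + j = k ∧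
      F mu1 a1 b1 i + F mu2 a2 b2 j ≤ F (mu1 + mu2) (a1 + a2) (b1 + b2) k := by
  have hF := F_ge (mu1 + mu2) (a1 + a2) (b1 + b2) k
  by_cases c1 : k ≤ a1 + a2
  · by_cases c2 : k ≤ a1
    · refine ⟨k, 0, by omega, by omega, by omega, ?_⟩
      rw [F_low c2 hab1, F_low (Nat.zero_le _) hab2]; omega
    · refine ⟨a1, k - a1, by omega, by omega, by omega, ?_⟩
      rw [F_low le_rfl hab1, F_low (by omega) hab2]; omega
  by_cases c2 : b1 + b2 ≤ k
  · by_cases c3 : k - b2 ≤ n1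
    · refine ⟨k - b2, b2, by omega, by omega, by omega, ?_⟩
      rw [F_high (by omega) hab1 hp1, F_high le_rfl hab2 hp2]; omega
    · refine ⟨n1, k - n1, by omega, by omega, by omega, ?_⟩
      rw [F_high (by omega) hab1 hp1, F_high (by omega) hab2 hp2]; omega
  by_cases c3 : k - a2 ≤ b1
  · refine ⟨k - a2, a2, by omega, by omega, by omega, ?_⟩
    rw [F_mid (by omega) (by omega), F_mid le_rfl hab2]; omega
  · refine ⟨b1, k - b1, by omega, by omega, by omega, ?_⟩
    rw [F_mid (by omega) (by omega), F_mid (by omega) (by omega)]; omega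

theorem true_low {mu1 a1 b1 mu2 a2 b2 a p q m : ℕ} 
    (hp1 : a1 % 2 = b1 % 2) (hp2 : a2 % 2 = b2 % 2)
    (ha : a = max (max (a1 - b2) (a2 - b1)) ((a1 + a2) % 2)) :
    F (mu1 + mu2) a (b1 + b2) (p + q) ≤ F mu1 a1 b1 (p + m) + F mu2 a2 b2 (q + m) := by
  have h1 := F_ge mu1 a1 b1 (p + m)
  have h2 := F_ge mu2 a2 b2 (q + m)
  have h3 : a % 2 = (a1 + a2) % 2 := by omega
  have h4 : a = a1 - b2 ∨ a = a2 - b1 ∨ a = (a1 + a2) % 2 := by omega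
  clear ha
  rw [F_le]
  refine ⟨?_, ?_, ?_⟩
  · rcases h4 with h4 | h4 | h4 <;> omega
  · omega
  · omega

theorem true_up' {mu1 a1 b1 n1 mu2 a2 b2 n2 k a : ℕ} (hab1 : a1 ≤ b1) (hb1 : b1 ≤ n1)
    (hp1 : a1 % 2 = b1 % 2) (hab2 : a2 ≤ b2) (hb2 : b2 ≤ n2)
    (hp2 : a2 % 2 = b2 % 2) (hk : k ≤ n1 + n2)
    (ha : a = max (max (a1 - b2) (a2 - b1)) ((a1 + a2) % 2)) :
    ∃ i j, i ≤ n1 ∧ j ≤ n2 ∧ k ≤ i + j ∧ i ≤ j + k ∧ j ≤ i + k ∧ (i + j) % 2 = k % 2 ∧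
      F mu1 a1 b1 i + F mu2 a2 b2 j ≤ F (mu1 + mu2) a (b1 + b2) k := by
  have h3 : a % 2 = (a1 + a2) % 2 := by omega
  have h4 : (a = a1 - b2 ∧ b2 ≤ a1) ∨ (a = a2 - b1 ∧ b1 ≤ a2) ∨
    (a = (a1 + a2) % 2 ∧ a1 ≤ b2 ∧ a2 ≤ b1) := by omega
  have h5 : a1 ≤ a + b2 ∧ a2 ≤ a + b1 := by omega
  clear ha
  have hF := F_ge (mu1 + mu2) a (b1 + b2) k
  by_cases c1 : k < a
  · rcases h4 with ⟨h4, h6⟩ | ⟨h4, h6⟩ | ⟨h4, h6, h7⟩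
    · refine ⟨k + b2, b2, by omega, by omega, by omega, by omega, by omega, by omega, ?_⟩
      rw [F_low (by omega) hab1, F_high le_rfl hab2 hp2]; omega
    · refine ⟨b1, k + b1, by omega, by omega, by omega, by omega, by omega, by omega, ?_⟩
      rw [F_high le_rfl hab1 hp1, F_low (by omega) hab2]; omega
    · by_cases c : a1 ≤ a2
      · refine ⟨a2, a2, by omega, by omega, by omega, by omega, by omega, by omega, ?_⟩
        rw [F_mid (by omega) (by omega), F_mid (by omega) (by omega)]; omega
      · refine ⟨a1, a1, by omega, by omega, by omega, by omega, by omega, by omega, ?_⟩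
        rw [F_mid (by omega) (by omega), F_mid (by omega) (by omega)]; omega
  clear h4
  by_cases c2 : b1 + b2 ≤ k
  · by_cases c3 : k - b2 ≤ n1
    · refine ⟨k - b2, b2, by omega, by omega, by omega, by omega, by omega, by omega, ?_⟩
      rw [F_high (by omega) hab1 hp1, F_high le_rfl hab2 hp2]; omega
    · refine ⟨n1, k - n1, by omega, by omega, by omega, by omega, by omega, by omega, ?_⟩
      rw [F_high (by omega) hab1 hp1, F_high (by omega) hab2 hp2]; omega
  by_cases c3 : b2 + k < b1
  · refine ⟨b2 + k, b2, by omega, by omega, by omega, by omega, by omega, by omega, ?_⟩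
    rw [F_mid (by omega) (by omega), F_mid (by omega) (by omega)]; omega
  by_cases c4 : b1 + k < b2
  · refine ⟨b1, b1 + k, by omega, by omega, by omega, by omega, by omega, by omega, ?_⟩
    rw [F_mid (by omega) (by omega), F_mid (by omega) (by omega)]; omega
  by_cases c5 : (k + a) % 2 = 0
  · refine ⟨b1, b2, by omega, by omega, by omega, by omega, by omega, by omega, ?_⟩
    rw [F_mid (by omega) (by omega), F_mid (by omega) (by omega)]; omega
  by_cases c6 : 1 ≤ b2
  · refine ⟨b1, b2 - 1, by omega, by omega, by omega, by omega, by omega, by omega, ?_⟩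
    have : F mu2 a2 b2 (b2 - 1) ≤ mu2 + 1 := F_le.2 (by omega)
    rw [F_mid (by omega) (by omega)]; omega
  · refine ⟨b1 - 1, b2, by omega, by omega, by omega, by omega, by omega, by omega, ?_⟩
    have : F mu1 a1 b1 (b1 - 1) ≤ mu1 + 1 := F_le.2 (by omega)
    rw [F_mid (a := a2) (by omega) (by omega)]; omega

theorem true_up {mu1 a1 b1 n1 mu2 a2 b2 n2 k a : ℕ} (hab1 : a1 ≤ b1) (hb1 : b1 ≤ n1)
    (hp1 : a1 % 2 = b1 % 2) (hab2 : a2 ≤ b2) (hb2 : b2 ≤ n2)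
    (hp2 : a2 % 2 = b2 % 2) (hk : k ≤ n1 + n2)
    (ha : a = max (max (a1 - b2) (a2 - b1)) ((a1 + a2) % 2)) :
    ∃ p q m, p + m ≤ n1 ∧ q + m ≤ n2 ∧ p + q = k ∧
      F mu1 a1 b1 (p + m) + F mu2 a2 b2 (q + m) ≤ F (mu1 + mu2) a (b1 + b2) k := by
  obtain ⟨i, j, h1, h2, h3, h4, h5, h6, h7⟩ :=
    true_up' (mu1 := mu1) (mu2 := mu2) hab1 hb1 hp1 hab2 hb2 hp2 hk ha
  have e1 : (k + i - j) / 2 + (i + j - k) / 2 = i := by omega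
  have e2 : (k + j - i) / 2 + (i + j - k) / 2 = j := by omega
  refine ⟨(k + i - j) / 2, (k + j - i) / 2, (i + j - k) / 2, ?_, ?_, by omega, ?_⟩
  · rwa [e1]
  · rwa [e2]
  · rwa [e1, e2]

theorem attach_low {mu1 a1 b1 mu2 a2 b2 mu a b k m : ℕ} 
    (hp1 : a1 % 2 = b1 % 2) (hp2 : a2 % 2 = b2 % 2) (hmu : mu = mu1 + mu2 + (a2 - b1))
    (hb : b = b1 - a2)
    (ha : b1 < a2 ∧ a = 0 ∨ a2 ≤ b1 ∧ a = max (a1 - b2) ((a1 + a2) % 2)) :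
    F mu a b k ≤ F mu1 a1 b1 (k + m) + F mu2 a2 b2 m := by
  have h1 := F_ge mu1 a1 b1 (k + m)
  have h2 := F_ge mu2 a2 b2 m
  rw [F_le]
  rcases ha with ⟨h, ha⟩ | ⟨h, ha⟩
  · have hmu' : mu + b1 = mu1 + mu2 + a2 := by omega
    have hb' : b = 0 := by omega
    clear hmu hb
    subst hb' ha
    refine ⟨by omega, by omega, by omega⟩
  · have h3 : a % 2 = (a1 + a2) % 2 := by omega
    have h4 : a = a1 - b2 ∨ a = (a1 + a2) % 2 := by omega
    have hmu' : mu = mu1 + mu2 := by omega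
    clear ha hmu
    subst hmu'
    refine ⟨?_, by omega, by omega⟩
    rcases h4 with h4 | h4 <;> omega

theorem attach_up {mu1 a1 b1 n1 mu2 a2 b2 n2 mu a b k : ℕ} (hab1 : a1 ≤ b1) (hb1 : b1 ≤ n1)
    (hp1 : a1 % 2 = b1 % 2) (hab2 : a2 ≤ b2) (hb2 : b2 ≤ n2)
    (hp2 : a2 % 2 = b2 % 2) (hk : k ≤ n1) (hk0 : 0 < k)
    (hmu : mu = mu1 + mu2 + (a2 - b1)) (hb : b = b1 - a2)
    (ha : b1 < a2 ∧ a = 0 ∨ a2 ≤ b1 ∧ a = max (a1 - b2) ((a1 + a2) % 2)) :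
    ∃ m, k + m ≤ n1 ∧ m ≤ n2 ∧ F mu1 a1 b1 (k + m) + F mu2 a2 b2 m ≤ F mu a b k := by
  have hF := F_ge mu a b k
  by_cases c1 : b1 ≤ k + a2
  · clear ha
    by_cases c2 : k + a2 ≤ n1
    · refine ⟨a2, by omega, by omega, ?_⟩
      rw [F_high (by omega) hab1 hp1, F_low le_rfl hab2]; omega
    · refine ⟨n1 - k, by omega, by omega, ?_⟩
      rw [F_high (by omega) hab1 hp1, F_low (by omega) hab2]; omega
  · have ha' : a = max (a1 - b2) ((a1 + a2) % 2) := by omega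
    have h3 : a % 2 = (a1 + a2) % 2 := by omega
    have h4 : (a = a1 - b2 ∧ b2 ≤ a1) ∨ a ≤ 1 := by omega
    have h5 : a1 ≤ a + b2 := by omega
    clear ha ha'
    have hmu' : mu = mu1 + mu2 := by omega
    subst hmu'
    by_cases c2 : k < a
    · refine ⟨b2, by omega, by omega, ?_⟩
      rw [F_low (by omega) hab1, F_high le_rfl hab2 hp2]; omega
    · by_cases c3 : a1 ≤ k + a2
      · refine ⟨a2, by omega, by omega, ?_⟩
        rw [F_mid (by omega) (by omega), F_mid (by omega) (by omega)]; omega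
      · refine ⟨a1 - k, by omega, by omega, ?_⟩
        rw [F_mid (by omega) (by omega), F_mid (by omega) (by omega)]; omega

theorem F_raise0 {mu k : ℕ} (hk : 0 < k) : F (mu + 1) 1 1 k = F mu 0 0 k := by
  rw [F_high hk le_rfl rfl, F_high (Nat.zero_le _) le_rfl rfl]; omega

theorem F_raise {mu b k : ℕ} (hb : 2 ≤ b) (hp : b % 2 = 0) (hk : 0 < k) :
    F mu 2 b k = F mu 0 b k := by
  by_cases h1 : k ≤ 2
  · rw [F_low h1 hb, F_mid (Nat.zero_le _) (by omega)]; omega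
  by_cases h2 : k ≤ b
  · rw [F_mid (by omega) h2, F_mid (by omega) h2]; omega
  · rw [F_high (by omega) hb (by omega), F_high (by omega) (by omega) (by omega)]

end TSGraph

namespace TSGraph

section Helpers

variable {α : Type*} [DecidableEq α]

/-- Common form of the three compositions (cross edges present iff `c`). -/
def Join (c : Prop) (G Gl Gr : TSGraph α) : Prop :=
  Disjoint Gl.verts Gr.verts ∧
  G.verts = Gl.verts ∪ Gr.verts ∧
  (∀ u v, G.Adj u v ↔ Gl.Adj u v ∨ Gr.Adj u v ∨
    (c ∧ ((u ∈ Gl.TS ∧ v ∈ Gr.TS) ∨ (u ∈ Gr.TS ∧ v ∈ Gl.TS))))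

theorem Join.swap {c : Prop} {G Gl Gr : TSGraph α} (h : Join c G Gl Gr) : Join c G Gr Gl := by
  obtain ⟨h1, h2, h3⟩ := h
  refine ⟨h1.symm, by rw [h2, Finset.union_comm], fun u v => ?_⟩
  rw [h3]; tauto

/-- The left half of a solution. -/
theorem half_adm {c : Prop} {G Gl Gr : TSGraph α} (hJ : Join c G Gl Gr) {S X : Finset α}
    {f : α → α}
    (hdom : ∀ v ∈ G.verts, v ∉ Gl.TS → v ∉ Gr.TS → v ∈ S ∨ ∃ u ∈ S, G.Adj u v)
    (hX : X ⊆ S) (hXT : X ⊆ Gl.TS ∪ Gr.TS) (hf : G.IsPM (S \ X) f) :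
    Gl.Adm ((X ∩ Gl.TS).card + ((S \ X).filter (fun v => v ∈ Gl.verts ∧ f v ∈ Gr.verts)).card)
      (S ∩ Gl.verts) := by
  obtain ⟨hd, hV, hA⟩ := hJ
  have hdis : ∀ v, v ∈ Gl.verts → v ∈ Gr.verts → False := fun v h1 h2 =>
    Finset.disjoint_left.1 hd h1 h2
  refine ⟨Finset.inter_subset_right, ?_, (X ∩ Gl.TS) ∪
    (S \ X).filter (fun v => v ∈ Gl.verts ∧ f v ∈ Gr.verts), ?_, ?_, f, ?_⟩
  · intro v hv hvT
    have hvr : v ∉ Gr.TS := fun h => hdis v hv (Gr.TS_sub h)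
    rcases hdom v (by rw [hV]; exact Finset.mem_union_left _ hv) hvT hvr with h | ⟨u, hu, h⟩
    · exact Or.inl (Finset.mem_inter.2 ⟨h, hv⟩)
    · rcases (hA u v).1 h with h | h | ⟨_, h | h⟩
      · exact Or.inr ⟨u, Finset.mem_inter.2 ⟨hu, (Gl.adj_mem _ _ h).1⟩, h⟩
      · exact (hdis v hv (Gr.adj_mem _ _ h).2).elim
      · exact (hvr h.2).elim
      · exact (hvT h.2).elim
  · intro v hv
    rcases Finset.mem_union.1 hv with h | h
    · have h := Finset.mem_inter.1 h
      simp [hX h.1, h.2, Gl.TS_sub h.2]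
    · obtain ⟨h1, h2, h3⟩ := Finset.mem_filter.1 h
      have h4 := (hf v h1).2.1
      have : v ∈ Gl.TS := by
        rcases (hA _ _).1 h4 with h | h | ⟨_, h | h⟩
        · exact (hdis _ (Gl.adj_mem _ _ h).2 h3).elim
        · exact (hdis _ h2 (Gr.adj_mem _ _ h).1).elim
        · exact h.1
        · exact (hdis _ h2 (Gr.TS_sub h.1)).elim
      simp [(Finset.mem_sdiff.1 h1).1, h2, this]
  · apply Finset.card_union_of_disjoint
    rw [Finset.disjoint_left]
    intro v h1 h2
    simp at h1 h2
    tauto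
  · intro v hv
    have hv' : v ∈ S ∧ v ∈ Gl.verts ∧ v ∉ X ∧ f v ∉ Gr.verts := by
      simp only [Finset.mem_sdiff, Finset.mem_inter, Finset.mem_union, Finset.mem_filter] at hv
      obtain ⟨⟨h1, h2⟩, h3⟩ := hv
      have hx : v ∉ X := by
        intro hx
        rcases Finset.mem_union.1 (hXT hx) with h | h
        · tauto
        · exact hdis _ h2 (Gr.TS_sub h)
      tauto
    obtain ⟨h1, h2, h3, h4⟩ := hv'
    obtain ⟨k1, k2, k3⟩ := hf v (Finset.mem_sdiff.2 ⟨h1, h3⟩)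
    have hadj : Gl.Adj v (f v) := by
      rcases (hA _ _).1 k2 with h | h | ⟨_, h | h⟩
      · exact h
      · exact (h4 (Gr.adj_mem _ _ h).2).elim
      · exact (h4 (Gr.TS_sub h.2)).elim
      · exact (hdis _ h2 (Gr.TS_sub h.1)).elim
    refine ⟨?_, hadj, k3⟩
    have := (Gl.adj_mem _ _ hadj).2
    have h5 := hdis v h2
    simp only [Finset.mem_sdiff, Finset.mem_inter, Finset.mem_union, Finset.mem_filter] at k1 ⊢
    rw [k3]
    tauto

theorem split_adm {c : Prop} {G Gl Gr : TSGraph α} (hJ : Join c G Gl Gr) {S X : Finset α}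
    {f : α → α} (hS : S ⊆ G.verts)
    (hdom : ∀ v ∈ G.verts, v ∉ Gl.TS → v ∉ Gr.TS → v ∈ S ∨ ∃ u ∈ S, G.Adj u v)
    (hX : X ⊆ S) (hXT : X ⊆ Gl.TS ∪ Gr.TS) (hf : G.IsPM (S \ X) f) :
    ∃ Sl Sr m, Gl.Adm ((X ∩ Gl.TS).card + m) Sl ∧ Gr.Adm ((X ∩ Gr.TS).card + m) Sr ∧
      (m = 0 ∨ c) ∧ S.card = Sl.card + Sr.card := by
  have h1 := half_adm hJ hdom hX hXT hf
  have h2 := half_adm hJ.swap (fun v h a b => hdom v h b a) hX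
    (by rwa [Finset.union_comm]) hf
  obtain ⟨hd, hV, hA⟩ := hJ
  have hdis : ∀ v, v ∈ Gl.verts → v ∈ Gr.verts → False := fun v h1 h2 =>
    Finset.disjoint_left.1 hd h1 h2
  have hc : ((S \ X).filter (fun v => v ∈ Gr.verts ∧ f v ∈ Gl.verts)).card =
      ((S \ X).filter (fun v => v ∈ Gl.verts ∧ f v ∈ Gr.verts)).card := by
    apply Finset.card_bij' (fun v _ => f v) (fun v _ => f v)
    · intro v hv
      obtain ⟨a, b, d⟩ := Finset.mem_filter.1 hv
      obtain ⟨k1, k2, k3⟩ := hf v a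
      exact Finset.mem_filter.2 ⟨k1, d, by rwa [k3]⟩
    · intro v hv
      obtain ⟨a, b, d⟩ := Finset.mem_filter.1 hv
      obtain ⟨k1, k2, k3⟩ := hf v a
      exact Finset.mem_filter.2 ⟨k1, d, by rwa [k3]⟩
    · intro v hv
      exact (hf v (Finset.mem_filter.1 hv).1).2.2
    · intro v hv
      exact (hf v (Finset.mem_filter.1 hv).1).2.2
  rw [hc] at h2
  refine ⟨_, _, _, h1, h2, ?_, ?_⟩
  · rcases Finset.eq_empty_or_nonempty
      ((S \ X).filter (fun v => v ∈ Gl.verts ∧ f v ∈ Gr.verts)) with h | ⟨v, hv⟩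
    · left; rw [h]; rfl
    · right
      obtain ⟨a, b, d⟩ := Finset.mem_filter.1 hv
      rcases (hA _ _).1 (hf v a).2.1 with h | h | ⟨h, _⟩
      · exact (hdis _ (Gl.adj_mem _ _ h).2 d).elim
      · exact (hdis _ b (Gr.adj_mem _ _ h).1).elim
      · exact h
  · rw [← Finset.card_union_of_disjoint, ← Finset.inter_union_distrib_left, ← hV,
      Finset.inter_eq_left.2 hS]
    rw [Finset.disjoint_left]
    intro v h1 h2
    exact hdis v (Finset.mem_inter.1 h1).2 (Finset.mem_inter.1 h2).2

theorem exists_biject {Y Z : Finset α} (h : Y.card = Z.card) :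
    ∃ g g' : α → α, (∀ v ∈ Y, g v ∈ Z ∧ g' (g v) = v) ∧ (∀ v ∈ Z, g' v ∈ Y ∧ g (g' v) = v) := by
  classical
  let e := Finset.equivOfCardEq h
  refine ⟨fun v => if hv : v ∈ Y then e ⟨v, hv⟩ else v,
    fun v => if hv : v ∈ Z then e.symm ⟨v, hv⟩ else v, ?_, ?_⟩
  · intro v hv
    simp [hv]
  · intro v hv
    simp [hv]

theorem merge_adm {c : Prop} {G Gl Gr : TSGraph α} (hJ : Join c G Gl Gr) {Sl Sr : Finset α}
    {p q m : ℕ} (hl : Gl.Adm (p + m) Sl) (hr : Gr.Adm (q + m) Sr) (hm : m = 0 ∨ c) :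
    Sl ∪ Sr ⊆ G.verts ∧ (Sl ∪ Sr).card = Sl.card + Sr.card ∧
    (∀ v ∈ G.verts, v ∉ Gl.TS → v ∉ Gr.TS → v ∈ Sl ∪ Sr ∨ ∃ u ∈ Sl ∪ Sr, G.Adj u v) ∧
    ∃ Xl ⊆ Sl ∩ Gl.TS, ∃ Xr ⊆ Sr ∩ Gr.TS, Xl.card = p ∧ Xr.card = q ∧
      ∃ f, G.IsPM ((Sl ∪ Sr) \ (Xl ∪ Xr)) f := by
  obtain ⟨hd, hV, hA⟩ := hJ
  have hdis : ∀ v, v ∈ Gl.verts → v ∈ Gr.verts → False := fun v h1 h2 =>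
    Finset.disjoint_left.1 hd h1 h2
  obtain ⟨l1, l2, X, hX, hXc, fl, hfl⟩ := hl
  obtain ⟨r1, r2, Z, hZ, hZc, fr, hfr⟩ := hr
  refine ⟨by rw [hV]; exact Finset.union_subset_union l1 r1,
    Finset.card_union_of_disjoint (Finset.disjoint_of_subset_left l1
      (Finset.disjoint_of_subset_right r1 hd)), ?_, ?_⟩
  · intro v hv h1 h2
    rw [hV] at hv
    rcases Finset.mem_union.1 hv with hv | hv
    · rcases l2 v hv h1 with h | ⟨u, hu, h⟩
      · exact Or.inl (Finset.mem_union_left _ h)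
      · exact Or.inr ⟨u, Finset.mem_union_left _ hu, (hA _ _).2 (Or.inl h)⟩
    · rcases r2 v hv h2 with h | ⟨u, hu, h⟩
      · exact Or.inl (Finset.mem_union_right _ h)
      · exact Or.inr ⟨u, Finset.mem_union_right _ hu, (hA _ _).2 (Or.inr (Or.inl h))⟩
  · obtain ⟨Y, hY, hYc⟩ := Finset.exists_subset_card_eq (show m ≤ X.card by omega)
    obtain ⟨W, hW, hWc⟩ := Finset.exists_subset_card_eq (show m ≤ Z.card by omega)
    obtain ⟨g, g', hg, hg'⟩ := exists_biject (hYc.trans hWc.symm)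
    have hXl : ∀ v ∈ X, v ∈ Sl ∧ v ∈ Gl.TS ∧ v ∈ Gl.verts ∧ v ∉ Gr.verts ∧ v ∉ Sr := by
      intro v hv
      have h := Finset.mem_inter.1 (hX hv)
      have h3 := Gl.TS_sub h.2
      exact ⟨h.1, h.2, h3, hdis v h3, fun h4 => hdis v h3 (r1 h4)⟩
    have hZr : ∀ v ∈ Z, v ∈ Sr ∧ v ∈ Gr.TS ∧ v ∈ Gr.verts ∧ v ∉ Gl.verts ∧ v ∉ Sl := by
      intro v hv
      have h := Finset.mem_inter.1 (hZ hv)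
      have h3 := Gr.TS_sub h.2
      exact ⟨h.1, h.2, h3, fun h5 => hdis v h5 h3, fun h4 => hdis v (l1 h4) h3⟩
    have hSS : ∀ v ∈ Sl, v ∉ Sr := fun v a b => hdis v (l1 a) (r1 b)
    refine ⟨X \ Y, Finset.sdiff_subset.trans hX, Z \ W, Finset.sdiff_subset.trans hZ, ?_, ?_,
      fun v => if v ∈ Sl \ X then fl v else if v ∈ Sr \ Z then fr v else
        if v ∈ Y then g v else g' v, ?_⟩
    · rw [Finset.card_sdiff_of_subset hY]; omega
    · rw [Finset.card_sdiff_of_subset hW]; omega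
    · intro v hv
      have hcases : v ∈ Sl \ X ∨ v ∈ Sr \ Z ∨ v ∈ Y ∨ v ∈ W := by
        simp only [Finset.mem_sdiff, Finset.mem_union] at hv ⊢
        tauto
      have hcm : ∀ u, u ∈ Y ∨ u ∈ W → c := by
        intro u hu
        rcases hm with rfl | h
        · rw [Finset.card_eq_zero] at hYc hWc
          simp [hYc, hWc] at hu
        · exact h
      rcases hcases with h | h | h | h
      · obtain ⟨a1, a2, a3⟩ := hfl v h
        have b := Finset.mem_sdiff.1 a1
        simp only [h, a1, if_true]
        refine ⟨?_, (hA _ _).2 (Or.inl a2), a3⟩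
        have : fl v ∉ Z := fun hz => (hZr _ hz).2.2.2.2 b.1
        simp only [Finset.mem_sdiff, Finset.mem_union]
        tauto
      · obtain ⟨a1, a2, a3⟩ := hfr v h
        have b := Finset.mem_sdiff.1 a1
        have n1 : v ∉ Sl \ X := fun h' =>
          hSS v (Finset.mem_sdiff.1 h').1 (Finset.mem_sdiff.1 h).1
        have n2 : fr v ∉ Sl \ X := fun h' => hSS _ (Finset.mem_sdiff.1 h').1 b.1
        simp only [h, a1, n1, n2, if_true, if_false]
        refine ⟨?_, (hA _ _).2 (Or.inr (Or.inl a2)), a3⟩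
        have : fr v ∉ X := fun hz => (hXl _ hz).2.2.2.2 b.1
        simp only [Finset.mem_sdiff, Finset.mem_union]
        tauto
      · obtain ⟨a1, a2⟩ := hg v h
        have x1 := hXl v (hY h)
        have z1 := hZr _ (hW a1)
        have n1 : v ∉ Sl \ X := fun h' => (Finset.mem_sdiff.1 h').2 (hY h)
        have n2 : v ∉ Sr \ Z := fun h' => x1.2.2.2.2 (Finset.mem_sdiff.1 h').1
        have n3 : g v ∉ Sl \ X := fun h' => z1.2.2.2.2 (Finset.mem_sdiff.1 h').1
        have n4 : g v ∉ Sr \ Z := fun h' => (Finset.mem_sdiff.1 h').2 (hW a1)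
        have n5 : g v ∉ X := fun h' => z1.2.2.2.2 (hXl _ h').1
        have n6 : g v ∉ Y := fun h' => n5 (hY h')
        simp only [h, n1, n2, n3, n4, n6, if_true, if_false]
        refine ⟨?_, (hA _ _).2 (Or.inr (Or.inr ⟨hcm v (Or.inl h), Or.inl ⟨x1.2.1, z1.2.1⟩⟩)), a2⟩
        simp only [Finset.mem_sdiff, Finset.mem_union]
        tauto
      · obtain ⟨a1, a2⟩ := hg' v h
        have z1 := hZr v (hW h)
        have x1 := hXl _ (hY a1)
        have n1 : v ∉ Sl \ X := fun h' => z1.2.2.2.2 (Finset.mem_sdiff.1 h').1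
        have n2 : v ∉ Sr \ Z := fun h' => (Finset.mem_sdiff.1 h').2 (hW h)
        have n0 : v ∉ Y := fun h' => z1.2.2.2.2 (hXl _ (hY h')).1
        have n3 : g' v ∉ Sl \ X := fun h' => (Finset.mem_sdiff.1 h').2 (hY a1)
        have n4 : g' v ∉ Sr \ Z := fun h' => x1.2.2.2.2 (Finset.mem_sdiff.1 h').1
        have n5 : g' v ∉ Z := fun h' => x1.2.2.2.2 (hZr _ h').1
        simp only [a1, n0, n1, n2, n3, n4, if_true, if_false]
        refine ⟨?_, (hA _ _).2 (Or.inr (Or.inr ⟨hcm v (Or.inr h), Or.inr ⟨z1.2.1, x1.2.1⟩⟩)), a2⟩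
        simp only [Finset.mem_sdiff, Finset.mem_union]
        tauto

theorem adm_le {G : TSGraph α} {k : ℕ} {S : Finset α} (h : G.Adm k S) : k ≤ G.TS.card := by
  obtain ⟨_, _, X, hX, rfl, _⟩ := h
  exact Finset.card_le_card (hX.trans Finset.inter_subset_right)

theorem pm_even {G : TSGraph α} {S : Finset α} {f : α → α} (h : G.IsPM S f) : S.card % 2 = 0 := by
  have : ∑ v ∈ S, (1 : ZMod 2) = 0 := by
    apply Finset.sum_involution (fun v _ => f v)
    · intros; decide
    · intro v hv _ he
      have := (h v hv).2.1
      rw [he] at this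
      exact G.irrefl _ this
    · intro v hv; exact (h v hv).1
    · intro v hv; exact (h v hv).2.2
  simp at this
  rw [ZMod.natCast_eq_zero_iff] at this
  omega

theorem adm_parity {G : TSGraph α} {k : ℕ} {S : Finset α} (h : G.Adm k S) :
    S.card % 2 = k % 2 := by
  obtain ⟨_, _, X, hX, rfl, f, hf⟩ := h
  have h1 := pm_even hf
  have h2 : X ⊆ S := hX.trans Finset.inter_subset_left
  rw [Finset.card_sdiff_of_subset h2] at h1
  have := Finset.card_le_card h2
  omega

/-- The shape invariant. -/
def Good (G : TSGraph α) : Prop :=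
  0 < G.TS.card ∧ ∃ mu a b, a ≤ b ∧ b ≤ G.TS.card ∧ a % 2 = b % 2 ∧
    (∀ k ≤ G.TS.card, ∃ S, G.Adm k S ∧ S.card = F mu a b k) ∧
    (∀ k S, G.Adm k S → F mu a b k ≤ S.card)

theorem Good.eq2 {G : TSGraph α} (h : Good G) : G.Eq2Holds := by
  obtain ⟨hn, mu, a, b, hab, hb, hpar, hex, hlow⟩ := h
  have hg : ∀ k ≤ G.TS.card, G.gamma k = F mu a b k := by
    intro k hk
    obtain ⟨S, hS, hc⟩ := hex k hk
    apply le_antisymm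
    · exact Nat.sInf_le ⟨S, hS, hc⟩
    · refine le_csInf ?_ ?_
      · exact ⟨_, S, hS, hc⟩
      · rintro n ⟨S', hS', rfl⟩
        exact hlow k S' hS'
  have hga : G.gamma a = mu := by rw [hg a (by omega), F_low le_rfl hab]; omega
  have hgb : G.gamma b = mu := by rw [hg b (by omega), F_high le_rfl hab hpar]; omega
  have hmin : G.minVal = mu := by
    apply le_antisymm
    · exact Nat.sInf_le ⟨a, by omega, hga⟩
    · refine le_csInf ?_ ?_
      · exact ⟨_, a, by omega, hga⟩
      · rintro n ⟨k, hk, rfl⟩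
        rw [hg k hk]; have := F_ge mu a b k; omega
  have hal : G.alphaVal = a := by
    apply le_antisymm
    · exact Nat.sInf_le ⟨by omega, by rw [hga, hmin]⟩
    · refine le_csInf ?_ ?_
      · exact ⟨a, by omega, by rw [hga, hmin]⟩
      · rintro k ⟨hk, hk'⟩
        rw [hg k hk, hmin] at hk'; have := F_ge mu a b k; omega
  have hbe : G.betaVal = b := by
    apply IsGreatest.csSup_eq
    refine ⟨⟨hb, by rw [hgb, hmin]⟩, ?_⟩
    rintro k ⟨hk, hk'⟩
    rw [hg k hk, hmin] at hk'; have := F_ge mu a b k; omega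
  intro k hk
  rw [hg k hk, hmin, hal, hbe]
  simp only [Nat.even_iff]
  refine ⟨?_, ?_, ?_, ?_⟩
  · intro h; rw [F_low h hab]; omega
  · intro h; rw [F_high h hab hpar]; omega
  · intro h1 h2 h3; rw [F_mid h1.le h2.le]; omega
  · intro h1 h2 h3; rw [F_mid h1.le h2.le]; omega

theorem good_single (G : TSGraph α) (v : α) (hv : G.verts = {v}) (hts : G.TS = {v}) : Good G := by
  refine ⟨by simp [hts], 0, 0, 0, le_rfl, by simp, rfl, ?_, ?_⟩
  · intro k hk
    rw [hts, Finset.card_singleton] at hk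
    rcases (show k = 0 ∨ k = 1 by omega) with rfl | rfl
    · refine ⟨∅, ⟨by simp, ?_, ∅, by simp, by simp, id, by intro v hv; simp at hv⟩, by simp [F]⟩
      rw [hv, hts]; tauto
    · refine ⟨{v}, ⟨by simp [hv], ?_, {v}, by simp [hts], by simp, id, by
        intro v hv; simp at hv⟩, by simp [F]⟩
      rw [hv, hts]; tauto
  · rintro k S ⟨_, _, X, hX, rfl, _⟩
    have h1 := Finset.card_le_card (hX.trans Finset.inter_subset_left)
    have h2 := Finset.card_le_card (hX.trans Finset.inter_subset_right)
    rw [hts, Finset.card_singleton] at h2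
    rw [F_le]; omega

theorem ts_card {c : Prop} {G Gl Gr : TSGraph α} (hJ : Join c G Gl Gr)
    (hT : G.TS = Gl.TS ∪ Gr.TS) : G.TS.card = Gl.TS.card + Gr.TS.card := by
  rw [hT]
  exact Finset.card_union_of_disjoint (Finset.disjoint_of_subset_left Gl.TS_sub
      (Finset.disjoint_of_subset_right Gr.TS_sub hJ.1))

theorem twin_upper {c : Prop} {G Gl Gr : TSGraph α} (hJ : Join c G Gl Gr)
    (hT : G.TS = Gl.TS ∪ Gr.TS) {Sl Sr : Finset α}
    {p q m : ℕ} (hl : Gl.Adm (p + m) Sl) (hr : Gr.Adm (q + m) Sr) (hm : m = 0 ∨ c) :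
    ∃ S, G.Adm (p + q) S ∧ S.card = Sl.card + Sr.card := by
  obtain ⟨h1, h2, h3, Xl, hXl, Xr, hXr, hp, hq, f, hf⟩ := merge_adm hJ hl hr hm
  refine ⟨Sl ∪ Sr, ⟨h1, ?_, Xl ∪ Xr, ?_, ?_, f, hf⟩, h2⟩
  · intro v hv hv'
    rw [hT, Finset.mem_union] at hv'
    exact h3 v hv (by tauto) (by tauto)
  · intro v hv
    rw [hT]
    have a := @hXl v
    have b := @hXr v
    simp only [Finset.mem_union, Finset.mem_inter] at *
    tauto
  · rw [Finset.card_union_of_disjoint, hp, hq]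
    exact Finset.disjoint_of_subset_left ((hXl.trans Finset.inter_subset_right).trans Gl.TS_sub)
      (Finset.disjoint_of_subset_right
        ((hXr.trans Finset.inter_subset_right).trans Gr.TS_sub) hJ.1)

theorem twin_lower {c : Prop} {G Gl Gr : TSGraph α} (hJ : Join c G Gl Gr)
    (hT : G.TS = Gl.TS ∪ Gr.TS) {S : Finset α} {k : ℕ} (h : G.Adm k S) :
    ∃ p q m Sl Sr, p + q = k ∧ (m = 0 ∨ c) ∧ Gl.Adm (p + m) Sl ∧ Gr.Adm (q + m) Sr ∧
      S.card = Sl.card + Sr.card := by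
  obtain ⟨h1, h2, X, hX, hk, f, hf⟩ := h
  have hXT : X ⊆ Gl.TS ∪ Gr.TS := by rw [← hT]; exact hX.trans Finset.inter_subset_right
  obtain ⟨Sl, Sr, m, a1, a2, a3, a4⟩ := split_adm hJ h1 (fun v hv hl hr => h2 v hv (by
    rw [hT, Finset.mem_union]; tauto)) (hX.trans Finset.inter_subset_left) hXT hf
  refine ⟨_, _, m, Sl, Sr, ?_, a3, a1, a2, a4⟩
  rw [← Finset.card_union_of_disjoint, ← Finset.inter_union_distrib_left,
      Finset.inter_eq_left.2 hXT, hk]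
  exact Finset.disjoint_of_subset_left (Finset.inter_subset_right.trans Gl.TS_sub)
      (Finset.disjoint_of_subset_right (Finset.inter_subset_right.trans Gr.TS_sub) hJ.1)

theorem good_false {G Gl Gr : TSGraph α} (hl : Good Gl) (hr : Good Gr)
    (h : IsFalseTwin G Gl Gr) : Good G := by
  have hJ : Join False G Gl Gr := ⟨h.1, h.2.1, fun u v => by rw [h.2.2.1]; tauto⟩
  have hT := h.2.2.2
  have hn := ts_card hJ hT
  obtain ⟨n1, mu1, a1, b1, hab1, hb1, hp1, hex1, hlow1⟩ := hl
  obtain ⟨n2, mu2, a2, b2, hab2, hb2, hp2, hex2, hlow2⟩ := hr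
  have hlow : ∀ k S, G.Adm k S → F (mu1 + mu2) (a1 + a2) (b1 + b2) k ≤ S.card := by
    intro k S hS
    obtain ⟨p, q, m, Sl, Sr, hpq, hm, hSl, hSr, hc⟩ := twin_lower hJ hT hS
    have hm : m = 0 := by tauto
    subst hm
    have h1 := hlow1 _ _ hSl
    have h2 := hlow2 _ _ hSr
    rw [hc]
    rw [← hpq]
    exact (false_low _ _ _ _ _ _ _ _).trans (add_le_add h1 h2)
  refine ⟨by omega, mu1 + mu2, a1 + a2, b1 + b2, by omega, by omega, by omega, ?_, hlow⟩
  · intro k hk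
    obtain ⟨i, j, hi, hj, hij, hF⟩ := false_up (mu1 := mu1) (mu2 := mu2) hab1 hb1 hp1 hab2 hb2 hp2
      (hn ▸ hk)
    obtain ⟨Sl, hSl, hcl⟩ := hex1 i hi
    obtain ⟨Sr, hSr, hcr⟩ := hex2 j hj
    obtain ⟨S, hS, hc⟩ := twin_upper (m := 0) (p := i) (q := j) hJ hT hSl hSr (Or.inl rfl)
    have := hlow k S (hij ▸ hS)
    exact ⟨S, hij ▸ hS, by omega⟩

theorem good_true {G Gl Gr : TSGraph α} (hl : Good Gl) (hr : Good Gr)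
    (h : IsTrueTwin G Gl Gr) : Good G := by
  have hJ : Join True G Gl Gr := ⟨h.1, h.2.1, fun u v => by rw [h.2.2.1]; tauto⟩
  have hT := h.2.2.2
  have hn := ts_card hJ hT
  obtain ⟨n1, mu1, a1, b1, hab1, hb1, hp1, hex1, hlow1⟩ := hl
  obtain ⟨n2, mu2, a2, b2, hab2, hb2, hp2, hex2, hlow2⟩ := hr
  obtain ⟨a, ha⟩ : ∃ a, a = max (max (a1 - b2) (a2 - b1)) ((a1 + a2) % 2) := ⟨_, rfl⟩
  have hlow : ∀ k S, G.Adm k S → F (mu1 + mu2) a (b1 + b2) k ≤ S.card := by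
    intro k S hS
    obtain ⟨p, q, m, Sl, Sr, hpq, hm, hSl, hSr, hc⟩ := twin_lower hJ hT hS
    have h1 := hlow1 _ _ hSl
    have h2 := hlow2 _ _ hSr
    rw [hc]
    rw [← hpq]
    exact (true_low hp1 hp2 ha).trans (add_le_add h1 h2)
  refine ⟨by omega, mu1 + mu2, a, b1 + b2, by omega, by omega, by omega, ?_, hlow⟩
  · intro k hk
    obtain ⟨p, q, m, hi, hj, hij, hF⟩ := true_up (mu1 := mu1) (mu2 := mu2) hab1 hb1 hp1 hab2 hb2
      hp2 (hn ▸ hk) ha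
    obtain ⟨Sl, hSl, hcl⟩ := hex1 _ hi
    obtain ⟨Sr, hSr, hcr⟩ := hex2 _ hj
    obtain ⟨S, hS, hc⟩ := twin_upper hJ hT hSl hSr (Or.inr trivial)
    have := hlow k S (hij ▸ hS)
    exact ⟨S, hij ▸ hS, by omega⟩

theorem attach_upper {G Gl Gr : TSGraph α} (hJ : Join True G Gl Gr)
    (hT : G.TS = Gl.TS) {Sl Sr : Finset α}
    {k m : ℕ} (hl : Gl.Adm (k + m) Sl) (hr : Gr.Adm m Sr) (hm : 0 < k + m) :
    ∃ S, G.Adm k S ∧ S.card = Sl.card + Sr.card := by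
  obtain ⟨u, huS, huT⟩ : ∃ u, u ∈ Sl ∧ u ∈ Gl.TS := by
    obtain ⟨_, _, X, hX, hXc, _⟩ := hl
    rw [← hXc, Finset.card_pos] at hm
    obtain ⟨u, hu⟩ := hm
    exact ⟨u, Finset.mem_inter.1 (hX hu)⟩
  obtain ⟨h1, h2, h3, Xl, hXl, Xr, hXr, hp, hq, f, hf⟩ :=
    merge_adm (q := 0) hJ hl (by rwa [Nat.zero_add]) (Or.inr trivial)
  rw [Finset.card_eq_zero] at hq
  subst hq
  rw [Finset.union_empty] at hf
  refine ⟨Sl ∪ Sr, ⟨h1, ?_, Xl, ?_, hp, f, hf⟩, h2⟩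
  · intro v hv hv'
    rw [hT] at hv'
    by_cases hr : v ∈ Gr.TS
    · exact Or.inr ⟨u, Finset.mem_union_left _ huS,
        (hJ.2.2 _ _).2 (Or.inr (Or.inr ⟨trivial, Or.inl ⟨huT, hr⟩⟩))⟩
    · exact h3 v hv hv' hr
  · rw [hT]
    exact hXl.trans (Finset.inter_subset_inter_right Finset.subset_union_left)

theorem attach_lower {G Gl Gr : TSGraph α} (hJ : Join True G Gl Gr)
    (hT : G.TS = Gl.TS) {S : Finset α} {k : ℕ} (h : G.Adm k S) :
    ∃ m Sl Sr, Gl.Adm (k + m) Sl ∧ Gr.Adm m Sr ∧ S.card = Sl.card + Sr.card := by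
  obtain ⟨h1, h2, X, hX, hk, f, hf⟩ := h
  have hXl : X ⊆ Gl.TS := by rw [← hT]; exact hX.trans Finset.inter_subset_right
  obtain ⟨Sl, Sr, m, a1, a2, a3, a4⟩ := split_adm hJ h1 (fun v hv hl hr => h2 v hv (by
    rwa [hT])) (hX.trans Finset.inter_subset_left) (hXl.trans Finset.subset_union_left) hf
  have e : X ∩ Gr.TS = ∅ := by
    rw [← Finset.disjoint_iff_inter_eq_empty]
    exact Finset.disjoint_of_subset_left (hXl.trans Gl.TS_sub)
      (Finset.disjoint_of_subset_right Gr.TS_sub hJ.1)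
  rw [Finset.inter_eq_left.2 hXl, hk] at a1
  rw [e, Finset.card_empty, Nat.zero_add] at a2
  exact ⟨m, Sl, Sr, a1, a2, a4⟩

/-- Raising the value at `0` if necessary. -/
theorem good_of_weak {G : TSGraph α} (hn : 0 < G.TS.card) (mu a b : ℕ) (hab : a ≤ b)
    (hb : b ≤ G.TS.card) (hp : a % 2 = b % 2)
    (hex : ∀ k ≤ G.TS.card, 0 < k → ∃ S, G.Adm k S ∧ S.card = F mu a b k)
    (hex0 : ∃ S, G.Adm 0 S ∧ S.card ≤ F mu a b 1 + 1)
    (hlow : ∀ k S, G.Adm k S → F mu a b k ≤ S.card) : Good G := by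
  by_cases h0 : ∃ S, G.Adm 0 S ∧ S.card = F mu a b 0
  · refine ⟨hn, mu, a, b, hab, hb, hp, ?_, hlow⟩
    intro k hk
    rcases Nat.eq_zero_or_pos k with rfl | h
    · exact h0
    · exact hex k hk h
  · have hlow0 : ∀ S, G.Adm 0 S → F mu a b 0 + 2 ≤ S.card := by
      intro S hS
      have h1 := hlow 0 S hS
      have h2 : S.card ≠ F mu a b 0 := fun e => h0 ⟨S, hS, e⟩
      obtain ⟨S', hS', hc⟩ := hex0
      have h3 := adm_parity hS
      have h5 : F mu a b 0 % 2 = 0 := by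
        obtain ⟨S1, hS1, hc1⟩ := hex 1 hn one_pos
        have h4 := adm_parity hS1
        by_cases h : b = 0
        · rw [F_high (by omega) hab hp] at hc1 ⊢; omega
        · by_cases h' : a = 0
          · rw [F_mid (by omega) (by omega)] at hc1 ⊢; omega
          · rw [F_low (by omega) hab] at hc1 ⊢; omega
      omega
    obtain ⟨S0, hS0, hc0⟩ := hex0
    have hl0 := hlow0 S0 hS0
    have ha : a = 0 := by
      by_contra h
      rw [F_low (by omega) hab] at hl0 hc0; omega
    subst ha
    rw [F_low le_rfl hab] at hl0
    by_cases hb0 : b = 0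
    · subst hb0
      rw [F_high (by omega) le_rfl rfl] at hc0
      refine ⟨hn, mu + 1, 1, 1, le_rfl, hn, rfl, ?_, ?_⟩
      · intro k hk
        rcases Nat.eq_zero_or_pos k with rfl | h
        · exact ⟨S0, hS0, by rw [F_low (by omega) (by omega)]; omega⟩
        · rw [F_raise0 h]
          exact hex k hk h
      · intro k S hS
        rcases Nat.eq_zero_or_pos k with rfl | h
        · have := hlow0 S hS
          rw [F_low (by omega) (by omega)] at this ⊢; omega
        · rw [F_raise0 h]
          exact hlow k S hS
    · rw [F_mid (by omega) (by omega)] at hc0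
      refine ⟨hn, mu, 2, b, by omega, hb, by omega, ?_, ?_⟩
      · intro k hk
        rcases Nat.eq_zero_or_pos k with rfl | h
        · exact ⟨S0, hS0, by rw [F_low (by omega) (by omega)]; omega⟩
        · rw [F_raise (by omega) (by omega) h]
          exact hex k hk h
      · intro k S hS
        rcases Nat.eq_zero_or_pos k with rfl | h
        · have := hlow0 S hS
          rw [F_low (by omega) (by omega)] at this ⊢; omega
        · rw [F_raise (by omega) (by omega) h]
          exact hlow k S hS

theorem good_attach {G Gl Gr : TSGraph α} (hl : Good Gl) (hr : Good Gr)
    (h : IsAttach G Gl Gr) : Good G := by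
  have hJ : Join True G Gl Gr := ⟨h.1, h.2.1, fun u v => by rw [h.2.2.1]; tauto⟩
  have hT := h.2.2.2
  obtain ⟨n1, mu1, a1, b1, hab1, hb1, hp1, hex1, hlow1⟩ := hl
  obtain ⟨n2, mu2, a2, b2, hab2, hb2, hp2, hex2, hlow2⟩ := hr
  obtain ⟨mu, hmu⟩ : ∃ mu, mu = mu1 + mu2 + (a2 - b1) := ⟨_, rfl⟩
  obtain ⟨b, hb⟩ : ∃ b, b = b1 - a2 := ⟨_, rfl⟩
  obtain ⟨a, ha⟩ : ∃ a, b1 < a2 ∧ a = 0 ∨ a2 ≤ b1 ∧ a = max (a1 - b2) ((a1 + a2) % 2) := by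
    by_cases h : b1 < a2
    · exact ⟨0, Or.inl ⟨h, rfl⟩⟩
    · exact ⟨_, Or.inr ⟨not_lt.1 h, rfl⟩⟩
  have hlow : ∀ k S, G.Adm k S → F mu a b k ≤ S.card := by
    intro k S hS
    obtain ⟨m, Sl, Sr, hSl, hSr, hc⟩ := attach_lower hJ hT hS
    have h1 := hlow1 _ _ hSl
    have h2 := hlow2 _ _ hSr
    rw [hc]
    exact (attach_low hp1 hp2 hmu hb ha).trans (add_le_add h1 h2)
  have hex : ∀ k ≤ G.TS.card, 0 < k → ∃ S, G.Adm k S ∧ S.card = F mu a b k := by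
    intro k hk hk0
    rw [hT] at hk
    obtain ⟨m, hi, hj, hF⟩ := attach_up hab1 hb1 hp1 hab2 hb2 hp2 hk hk0 hmu hb ha
    obtain ⟨Sl, hSl, hcl⟩ := hex1 _ hi
    obtain ⟨Sr, hSr, hcr⟩ := hex2 _ hj
    obtain ⟨S, hS, hc⟩ := attach_upper hJ hT hSl hSr (by omega)
    have := hlow k S hS
    exact ⟨S, hS, by omega⟩
  refine good_of_weak (by rwa [hT]) mu a b (by omega) (by rw [hT]; omega)
    (by omega) hex ?_ hlow
  · obtain ⟨S, hS, hc⟩ := hex 1 (by rw [hT]; omega) one_pos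
    obtain ⟨m, Sl, Sr, hSl, hSr, hc'⟩ := attach_lower hJ hT hS
    have h1 := hlow1 _ _ hSl
    have h2 := hlow2 _ _ hSr
    have h3 := adm_le hSl
    have h4 := adm_le hSr
    obtain ⟨m', hm0, hm1, hm2, hF⟩ : ∃ m', 0 < m' ∧ m' ≤ Gl.TS.card ∧ m' ≤ Gr.TS.card ∧
        F mu1 a1 b1 m' + F mu2 a2 b2 m' ≤ F mu1 a1 b1 (1 + m) + F mu2 a2 b2 m + 1 := by
      by_cases hm : m = 0
      · subst hm
        have := F_succ mu2 a2 b2 0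
        exact ⟨1, by omega, by omega, by omega, by simp only [Nat.add_zero, Nat.zero_add] at *; omega⟩
      · have := F_pred mu1 a1 b1 m
        exact ⟨m, by omega, by omega, by omega, by rw [Nat.add_comm 1 m]; omega⟩
    obtain ⟨Tl, hTl, hcl⟩ := hex1 _ hm1
    obtain ⟨Tr, hTr, hcr⟩ := hex2 _ hm2
    obtain ⟨T, hT', hcT⟩ := attach_upper (k := 0) hJ hT (by rwa [Nat.zero_add]) hTr (by omega)
    exact ⟨T, hT', by omega⟩

end Helpers

end TSGraph

open TSGraph in
/-- If `(H, TS(H))` arises from a decomposition tree in which every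
occurring twin-set graph has all families `D_k` nonempty, then Equation (2) holds
for `H`. -/
theorem stmt2 {α : Type*} [DecidableEq α] (H : TSGraph α)
    (h : FromDecompTree AllDkNonempty H) :
    H.Eq2Holds := by
  apply Good.eq2
  induction h with
  | single G v hv hts _ _ => exact good_single G v hv hts
  | ttwin G Gl Gr _ _ h _ ihl ihr => exact good_true ihl ihr h
  | ftwin G Gl Gr _ _ h _ ihl ihr => exact good_false ihl ihr h
  | attach G Gl Gr _ _ h _ ihl ihr => exact good_attach ihl ihr h
end

section
/- Let G = G_l ⊗ G_r be a true twin composition, and assume D_k(H) ≠ ∅ for each H ∈ {G, G_l, G_r} and each 0 ≤ k ≤ |TS(H)|. Then min(G) = min(G_l) + min(G_r). -/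
namespace TSGraph

theorem aux_minVal_le {α : Type*} [DecidableEq α] (G : TSGraph α) (k : ℕ) (S : Finset α)
    (h : G.Adm k S) : G.minVal ≤ S.card := by
  obtain ⟨X, hX, hk, -⟩ := h.2.2
  have hk' : k ≤ G.TS.card := by
    rw [← hk]
    exact Finset.card_le_card (hX.trans Finset.inter_subset_right)
  have h1 : G.minVal ≤ G.gamma k := Nat.sInf_le ⟨k, hk', rfl⟩
  have h2 : G.gamma k ≤ S.card := Nat.sInf_le ⟨S, h, rfl⟩
  exact h1.trans h2

theorem aux_minVal_attained {α : Type*} [DecidableEq α] (G : TSGraph α) (h : G.AllDkNonempty) :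
    ∃ k S, G.Adm k S ∧ S.card = G.minVal := by
  obtain ⟨k, hk, hk2⟩ : G.minVal ∈ {n | ∃ k ≤ G.TS.card, G.gamma k = n} :=
    Nat.sInf_mem ⟨_, 0, Nat.zero_le _, rfl⟩
  obtain ⟨T, hT⟩ := h k hk
  obtain ⟨S, hS, hS2⟩ : G.gamma k ∈ {n | ∃ S, G.Adm k S ∧ S.card = n} :=
    Nat.sInf_mem ⟨_, T, hT.1, rfl⟩
  exact ⟨k, S, hS, hS2.trans hk2⟩

theorem aux_symm {α : Type*} [DecidableEq α] {G Gl Gr : TSGraph α}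
    (h : IsTrueTwin G Gl Gr) : IsTrueTwin G Gr Gl := by
  obtain ⟨h1, h2, h3, h4⟩ := h
  refine ⟨h1.symm, by rw [h2, Finset.union_comm], ?_, by rw [h4, Finset.union_comm]⟩
  intro u v
  rw [h3]
  tauto

theorem aux_restrict {α : Type*} [DecidableEq α] {G Gl Gr : TSGraph α}
    (h : IsTrueTwin G Gl Gr) {k : ℕ} {S : Finset α} (hS : G.Adm k S) :
    ∃ k', Gl.Adm k' (S ∩ Gl.verts) := by
  obtain ⟨h1, h2, h3, h4⟩ := h
  obtain ⟨hs, hd, X, hX, -, f, hf⟩ := hS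
  rw [Finset.disjoint_left] at h1
  refine ⟨_, Finset.inter_subset_right, ?_,
    (S ∩ Gl.verts).filter (fun v => v ∈ X ∨ f v ∉ Gl.verts), ?_, rfl, f, ?_⟩
  · intro v hv hvT
    have hvr : v ∉ Gr.verts := h1 hv
    have hvrT : v ∉ Gr.TS := fun hh => hvr (Gr.TS_sub hh)
    rcases hd v (by simp [h2, hv]) (by simp [h4, hvT, hvrT]) with hh | ⟨u, hu, huv⟩
    · left; simp [hh, hv]
    · right
      rw [h3] at huv
      rcases huv with huv | huv | huv | huv
      · exact ⟨u, Finset.mem_inter.2 ⟨hu, (Gl.adj_mem _ _ huv).1⟩, huv⟩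
      · exact absurd (Gr.adj_mem _ _ huv).2 hvr
      · exact absurd huv.2 hvrT
      · exact absurd huv.2 hvT
  · intro v hv
    rw [Finset.mem_filter, Finset.mem_inter] at hv
    obtain ⟨⟨hvS, hvl⟩, hv⟩ := hv
    have hvr : v ∉ Gr.verts := h1 hvl
    have hvrT : v ∉ Gr.TS := fun hh => hvr (Gr.TS_sub hh)
    suffices hT : v ∈ Gl.TS by simp [hvS, hvl, hT]
    by_cases hvX : v ∈ X
    · have := (Finset.mem_inter.1 (hX hvX)).2
      rw [h4, Finset.mem_union] at this
      tauto
    · have hv' : f v ∉ Gl.verts := by tauto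
      have ha := (hf v (Finset.mem_sdiff.2 ⟨hvS, hvX⟩)).2.1
      rw [h3] at ha
      rcases ha with ha | ha | ha | ha
      · exact absurd (Gl.adj_mem _ _ ha).2 hv'
      · exact absurd (Gr.adj_mem _ _ ha).1 hvr
      · exact ha.1
      · exact absurd ha.1 hvrT
  · intro v hv
    simp only [Finset.mem_sdiff, Finset.mem_filter, Finset.mem_inter, not_and, not_or,
      not_not] at hv
    obtain ⟨⟨hvS, hvl⟩, hv⟩ := hv
    obtain ⟨hvX, hfl⟩ := hv ⟨hvS, hvl⟩
    obtain ⟨a, b, c⟩ := hf v (Finset.mem_sdiff.2 ⟨hvS, hvX⟩)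
    rw [Finset.mem_sdiff] at a
    have hvr : v ∉ Gr.verts := h1 hvl
    have hfr : f v ∉ Gr.verts := h1 hfl
    refine ⟨?_, ?_, c⟩
    · simp [a.1, a.2, hfl, c, hvl]
    · rw [h3] at b
      rcases b with b | b | b | b
      · exact b
      · exact absurd (Gr.adj_mem _ _ b).1 hvr
      · exact absurd (Gr.TS_sub b.2) hfr
      · exact absurd (Gr.TS_sub b.1) hvr

theorem aux_union {α : Type*} [DecidableEq α] {G Gl Gr : TSGraph α}
    (h : IsTrueTwin G Gl Gr) {k m : ℕ} {S T : Finset α} (hS : Gl.Adm k S) (hT : Gr.Adm m T) :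
    ∃ k', G.Adm k' (S ∪ T) := by
  obtain ⟨h1, h2, h3, h4⟩ := h
  obtain ⟨hs, hd, X, hX, -, f, hf⟩ := hS
  obtain ⟨hs', hd', Y, hY, -, g, hg⟩ := hT
  rw [Finset.disjoint_left] at h1
  refine ⟨_, ?_, ?_, X ∪ Y, ?_, rfl, fun v => if v ∈ Gl.verts then f v else g v, ?_⟩
  · rw [h2]; exact Finset.union_subset_union hs hs'
  · intro v hv hvT
    rw [h2, Finset.mem_union] at hv
    rw [h4, Finset.mem_union, not_or] at hvT
    rcases hv with hv | hv
    · rcases hd v hv hvT.1 with hh | ⟨u, hu, hh⟩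
      · left; simp [hh]
      · exact Or.inr ⟨u, by simp [hu], (h3 _ _).2 (Or.inl hh)⟩
    · rcases hd' v hv hvT.2 with hh | ⟨u, hu, hh⟩
      · left; simp [hh]
      · exact Or.inr ⟨u, by simp [hu], (h3 _ _).2 (Or.inr (Or.inl hh))⟩
  · rw [h4]
    intro v hv
    rcases Finset.mem_union.1 hv with hv | hv
    · have := Finset.mem_inter.1 (hX hv)
      simp [this.1, this.2]
    · have := Finset.mem_inter.1 (hY hv)
      simp [this.1, this.2]
  · intro v hv
    simp only [Finset.mem_sdiff, Finset.mem_union, not_or] at hv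
    obtain ⟨hv, hvX, hvY⟩ := hv
    have hXS : ∀ x ∈ X, x ∈ S := fun x hx => (Finset.mem_inter.1 (hX hx)).1
    have hYT : ∀ x ∈ Y, x ∈ T := fun x hx => (Finset.mem_inter.1 (hY hx)).1
    rcases hv with hv | hv
    · obtain ⟨a, b, c⟩ := hf v (Finset.mem_sdiff.2 ⟨hv, hvX⟩)
      rw [Finset.mem_sdiff] at a
      have hfY : f v ∉ Y := fun hh => h1 (hs a.1) (hs' (hYT _ hh))
      have e1 := hs hv
      have e2 := hs a.1
      simp only [e1, e2, if_true, Finset.mem_sdiff, Finset.mem_union, not_or]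
      exact ⟨⟨Or.inl a.1, a.2, hfY⟩, (h3 _ _).2 (Or.inl b), c⟩
    · obtain ⟨a, b, c⟩ := hg v (Finset.mem_sdiff.2 ⟨hv, hvY⟩)
      rw [Finset.mem_sdiff] at a
      have hfX : g v ∉ X := fun hh => h1 (hs (hXS _ hh)) (hs' a.1)
      have e1 : v ∉ Gl.verts := fun hh => h1 hh (hs' hv)
      have e2 : g v ∉ Gl.verts := fun hh => h1 hh (hs' a.1)
      simp only [e1, e2, if_false, Finset.mem_sdiff, Finset.mem_union, not_or]
      exact ⟨⟨Or.inr a.1, hfX, a.2⟩, (h3 _ _).2 (Or.inr (Or.inl b)), c⟩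

end TSGraph

open TSGraph in
/-- For a true twin composition `G = Gl ⊗ Gr` with all `D_k`
families nonempty, `min(G) = min(Gl) + min(Gr)`. -/
theorem stmt6 {α : Type*} [DecidableEq α] (G Gl Gr : TSGraph α)
    (hcomp : IsTrueTwin G Gl Gr)
    (hG : G.AllDkNonempty) (hGl : Gl.AllDkNonempty) (hGr : Gr.AllDkNonempty) :
    G.minVal = Gl.minVal + Gr.minVal := by
  apply le_antisymm
  · obtain ⟨k, S, hS, e⟩ := aux_minVal_attained Gl hGl
    obtain ⟨m, T, hT, e'⟩ := aux_minVal_attained Gr hGr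
    obtain ⟨n, hn⟩ := aux_union hcomp hS hT
    rw [← e, ← e']
    exact (aux_minVal_le G n _ hn).trans (Finset.card_union_le _ _)
  · obtain ⟨k, S, hS, e⟩ := aux_minVal_attained G hG
    obtain ⟨a, ha⟩ := aux_restrict hcomp hS
    obtain ⟨b, hb⟩ := aux_restrict (aux_symm hcomp) hS
    have h1 := aux_minVal_le _ _ _ ha
    have h2 := aux_minVal_le _ _ _ hb
    have hdisj : Disjoint (S ∩ Gl.verts) (S ∩ Gr.verts) :=
      hcomp.1.mono Finset.inter_subset_right Finset.inter_subset_right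
    have h3 := Finset.card_union_of_disjoint hdisj
    have h4 : (S ∩ Gl.verts ∪ S ∩ Gr.verts).card ≤ S.card :=
      Finset.card_le_card (Finset.union_subset Finset.inter_subset_left Finset.inter_subset_left)
    omega
end
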